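/- arXiv:1502.07873 — 3 statements merged into one kernel-verified Lean document; each statement's English description precedes it below -/
import Mathlib

section
/- Let p̃ be the density of the multivariate Gaussian distribution N(μ, Σ) on ℝ^n with Σ symmetric positive definite, and let h : ℝ^n → ℝ be five times continuously differentiable with all partial derivatives of orders 3, 4 and 5 bounded. Then there is a constant C, depending only on n and these derivative bounds, such that | ∫_{ℝ^n} h(θ) p̃(θ) dθ − h(μ) − (1/2) Σ : ∇∇h(μ) | ≤ C ( ‖Σ‖² + ‖Σ‖^{5/2} ), where Σ : ∇∇h(μ) = Σ_{i,j} Σ_{ij} ∂²h/∂θ_i∂θ_j(μ). In particular, the odd central moments of the Gaussian annihilate the odd-order Taylor terms, and the fourth-order term is bounded by a quadratic form in Σ. -/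
open MeasureTheory Real Matrix

noncomputable section

/-- Density of the multivariate Gaussian `N(μ, S)` on `ℝ^n`. -/
def gaussPdfMean {n : ℕ} (μ : Fin n → ℝ) (S : Matrix (Fin n) (Fin n) ℝ)
    (θ : Fin n → ℝ) : ℝ :=
  (2 * π) ^ (-(n : ℝ) / 2) * S.det ^ (-(1 : ℝ) / 2) *
    Real.exp (-(1 / 2) * dotProduct (θ - μ) (S⁻¹.mulVec (θ - μ)))

/-- The operator (`ℓ² → ℓ²`) norm of a square real matrix. -/
def opNorm {n : ℕ} (A : Matrix (Fin n) (Fin n) ℝ) : ℝ :=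
  ‖Matrix.toEuclideanCLM (𝕜 := ℝ) A‖

/-- Second partial derivative `∂²h/∂θ_i∂θ_j`. -/
def hess {n : ℕ} (h : (Fin n → ℝ) → ℝ) (θ : Fin n → ℝ) (i j : Fin n) : ℝ :=
  fderiv ℝ (fun x => fderiv ℝ h x (Pi.single j 1)) θ (Pi.single i 1)

open ProbabilityTheory

theorem pi_gaussianReal_eq_withDensity (ι : Type*) [Fintype ι] :
    Measure.pi (fun _ : ι => gaussianReal 0 1) =
      (volume : Measure (ι → ℝ)).withDensity
        (fun x => ENNReal.ofReal (∏ i, gaussianPDFReal 0 1 (x i))) := by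
  refine Measure.pi_eq fun s hs => ?_
  have hint (i : ι) : Integrable (gaussianPDFReal 0 1) (volume.restrict (s i)) :=
    (integrable_gaussianPDFReal 0 1).restrict
  rw [withDensity_apply _ (MeasurableSet.univ_pi hs), volume_pi, Measure.restrict_pi_pi,
    ← ofReal_integral_eq_lintegral_ofReal (Integrable.fintype_prod hint)
      (ae_of_all _ fun x => Finset.prod_nonneg fun i _ => gaussianPDFReal_nonneg _ _ _),
    integral_fintype_prod_eq_prod (fun _ => gaussianPDFReal 0 1), ENNReal.ofReal_prod_of_nonneg]
  · simp_rw [gaussianReal_apply_eq_integral 0 one_ne_zero]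
  · exact fun i _ => integral_nonneg fun x => gaussianPDFReal_nonneg _ _ _

theorem integral_pi_gaussianReal (ι : Type*) [Fintype ι] (f : (ι → ℝ) → ℝ) :
    ∫ x, f x ∂Measure.pi (fun _ : ι => gaussianReal 0 1) =
      ∫ x, f x * ∏ i, gaussianPDFReal 0 1 (x i) := by
  rw [pi_gaussianReal_eq_withDensity, integral_withDensity_eq_integral_toReal_smul
    (by fun_prop) (ae_of_all _ fun _ => ENNReal.ofReal_lt_top)]
  refine integral_congr_ae (ae_of_all _ fun x => ?_)
  simp only [smul_eq_mul]
  rw [ENNReal.toReal_ofReal (Finset.prod_nonneg fun i _ => gaussianPDFReal_nonneg _ _ _), mul_comm]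

theorem iteratedDeriv_comp_add_smul {E : Type*} [NormedAddCommGroup E] [NormedSpace ℝ E]
    {h : E → ℝ} {k : ℕ} (hh : ContDiff ℝ k h) (x v : E) (t : ℝ) :
    iteratedDeriv k (fun t : ℝ => h (x + t • v)) t =
      iteratedFDeriv ℝ k h (x + t • v) fun _ => v := by
  have := (ContinuousLinearMap.toSpanSingleton ℝ v).iteratedFDeriv_comp_right
    (f := fun y => h (x + y)) (hh.comp (contDiff_const.add contDiff_id)) t le_rfl
  rw [iteratedDeriv_eq_iteratedFDeriv]
  change iteratedFDeriv ℝ k ((fun y => h (x + y)) ∘ ContinuousLinearMap.toSpanSingleton ℝ v) t _ = _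
  rw [this, iteratedFDeriv_comp_add_left]
  simp

theorem abs_taylor_three_remainder_le {E : Type*} [NormedAddCommGroup E] [NormedSpace ℝ E]
    {h : E → ℝ} (hh : ContDiff ℝ 4 h) {B : ℝ} (hB : ∀ x, ‖iteratedFDeriv ℝ 4 h x‖ ≤ B) (x v : E) :
    |h (x + v) - h x - iteratedFDeriv ℝ 1 h x (fun _ => v)
      - 1 / 2 * iteratedFDeriv ℝ 2 h x (fun _ => v)
      - 1 / 6 * iteratedFDeriv ℝ 3 h x (fun _ => v)| ≤ B / 24 * ‖v‖ ^ 4 := by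
  let u : ℝ → ℝ := fun t => h (x + t • v)
  have hu : ContDiff ℝ 4 u := hh.comp (by fun_prop)
  have hderiv (k : ℕ) (hk : k ≤ 4) (t : ℝ) :
      iteratedDeriv k u t = iteratedFDeriv ℝ k h (x + t • v) fun _ => v :=
    iteratedDeriv_comp_add_smul (hh.of_le (by exact_mod_cast hk)) x v t
  have hwithin (k : ℕ) (hk : k ≤ 4) :
      iteratedDerivWithin k u (Set.uIcc 0 1) 0 = iteratedFDeriv ℝ k h x fun _ => v := by
    rw [iteratedDerivWithin_eq_iteratedDeriv (uniqueDiffOn_uIcc zero_ne_one)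
      (hu.of_le (by exact_mod_cast hk)).contDiffAt (by simp), hderiv k hk]
    simp
  obtain ⟨t, -, ht⟩ := taylor_mean_remainder_lagrange_iteratedDeriv (f := u) (n := 3)
    (zero_ne_one' ℝ) (by norm_num; exact hu.contDiffOn)
  rw [hderiv _ le_rfl] at ht
  simp only [taylorWithinEval_succ, taylor_within_zero_eval] at ht
  rw [hwithin _ (by norm_num), hwithin _ (by norm_num), hwithin _ (by norm_num)] at ht
  norm_num [Nat.factorial] at ht
  have hu1 : u 1 = h (x + v) := by simp [u]
  have hu0 : u 0 = h x := by simp [u]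
  rw [hu1, hu0] at ht
  have hle : |iteratedFDeriv ℝ 4 h (x + t • v) fun _ => v| ≤ B * ‖v‖ ^ 4 := by
    refine ((iteratedFDeriv ℝ 4 h (x + t • v)).le_opNorm _).trans ?_
    simpa using mul_le_mul_of_nonneg_right (hB (x + t • v)) (by positivity)
  calc _ = |(iteratedFDeriv ℝ 4 h (x + t • v) fun _ => v) / 24| := by
        rw [← ht, iteratedFDeriv_one_apply]
        ring_nf
    _ ≤ _ := by
        rw [abs_div]
        norm_num
        linarith

theorem integral_comp_toLin' {n : ℕ} (A : Matrix (Fin n) (Fin n) ℝ) (hA : A.det ≠ 0)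
    {f : (Fin n → ℝ) → ℝ} (hf : Continuous f) :
    ∫ z, f (A *ᵥ z) = |A.det|⁻¹ * ∫ θ, f θ := by
  have h := integral_map (μ := volume) (φ := toLin' A) (f := f) (by fun_prop)
    hf.aestronglyMeasurable
  rw [Real.map_matrix_volume_pi_eq_smul_volume_pi hA, integral_smul_measure] at h
  simpa [abs_inv] using h.symm

theorem gaussPdfMean_mul_transpose {n : ℕ} (μ : Fin n → ℝ) (A : Matrix (Fin n) (Fin n) ℝ)
    (hA : A.det ≠ 0) (z : Fin n → ℝ) :
    gaussPdfMean μ (A * Aᵀ) (μ + A *ᵥ z) = |A.det|⁻¹ * ∏ i, gaussianPDFReal 0 1 (z i) := by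
  have hu : IsUnit A.det := hA.isUnit
  have hquad : (A *ᵥ z) ⬝ᵥ ((A * Aᵀ)⁻¹ *ᵥ (A *ᵥ z)) = ∑ i, z i ^ 2 := by
    rw [Matrix.mul_inv_rev, ← mulVec_mulVec, mulVec_mulVec z A⁻¹ A, nonsing_inv_mul _ hu,
      one_mulVec, dotProduct_mulVec, ← transpose_nonsing_inv, vecMul_transpose, mulVec_mulVec,
      nonsing_inv_mul _ hu, one_mulVec]
    simp [dotProduct, sq]
  have hdet : (A * Aᵀ).det ^ (-(1 : ℝ) / 2) = |A.det|⁻¹ := by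
    rw [det_mul, det_transpose, ← sq, neg_div, Real.rpow_neg (sq_nonneg _), ← Real.sqrt_eq_rpow,
      Real.sqrt_sq_eq_abs]
  have hpi : (2 * π) ^ (-(n : ℝ) / 2) = (√(2 * π))⁻¹ ^ n := by
    rw [Real.sqrt_eq_rpow, ← Real.rpow_neg (by positivity), ← Real.rpow_mul_natCast (by positivity)]
    congr 1; ring
  simp only [gaussPdfMean, add_sub_cancel_left, hquad, hdet, hpi, gaussianPDFReal,
    Finset.prod_mul_distrib, ← Real.exp_sum]
  have hsum : -(1 / 2) * ∑ i, z i ^ 2 = ∑ i, -z i ^ 2 / 2 := by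
    rw [Finset.mul_sum]
    exact Finset.sum_congr rfl fun _ _ => by ring
  rw [hsum]
  simp
  ring

theorem continuous_gaussPdfMean {n : ℕ} (μ : Fin n → ℝ) (S : Matrix (Fin n) (Fin n) ℝ) :
    Continuous (gaussPdfMean μ S) := by
  unfold gaussPdfMean
  fun_prop

theorem exists_eq_mul_transpose {n : ℕ} {S : Matrix (Fin n) (Fin n) ℝ} (hS : S.PosDef) :
    ∃ A : Matrix (Fin n) (Fin n) ℝ, A.det ≠ 0 ∧ S = A * Aᵀ := by
  open scoped MatrixOrder Matrix.Norms.L2Operator in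
  obtain ⟨B, hB⟩ := CStarAlgebra.nonneg_iff_eq_star_mul_self.mp hS.posSemidef.nonneg
  refine ⟨Bᵀ, fun h => hS.det_pos.ne' ?_, by rw [hB]; rfl⟩
  rw [hB, det_mul, ← det_transpose B, h, mul_zero]

theorem apply_self_le_opNorm {n : ℕ} (S : Matrix (Fin n) (Fin n) ℝ) (i : Fin n) :
    S i i ≤ opNorm S := by
  have h := (toEuclideanCLM (𝕜 := ℝ) S).le_opNorm (EuclideanSpace.single i 1)
  rw [PiLp.norm_single, norm_one, mul_one] at h
  refine le_trans ?_ h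
  have := PiLp.norm_apply_le (toEuclideanCLM (𝕜 := ℝ) S (EuclideanSpace.single i 1)) i
  refine (le_abs_self _).trans (le_trans (le_of_eq ?_) this)
  simp [ofLp_toEuclideanCLM]

theorem norm_mulVec_sq_le {n : ℕ} (A : Matrix (Fin n) (Fin n) ℝ) (z : Fin n → ℝ) :
    ‖A *ᵥ z‖ ^ 2 ≤ opNorm (A * Aᵀ) * (n * ‖z‖ ^ 2) := by
  have hz : ∑ j, z j ^ 2 ≤ n * ‖z‖ ^ 2 := by
    have : ∀ j ∈ Finset.univ, z j ^ 2 ≤ ‖z‖ ^ 2 := fun j _ =>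
      sq_le_sq.2 (by simpa using norm_le_pi_norm z j)
    simpa using Finset.sum_le_card_nsmul _ _ _ this
  refine (Real.le_sqrt (norm_nonneg _) (by unfold opNorm; positivity)).1 ?_
  refine (pi_norm_le_iff_of_nonneg (Real.sqrt_nonneg _)).2 fun i => Real.abs_le_sqrt ?_
  calc (A *ᵥ z) i ^ 2 ≤ (∑ j, A i j ^ 2) * ∑ j, z j ^ 2 := by
          simpa [mulVec, dotProduct] using Finset.sum_mul_sq_le_sq_mul_sq Finset.univ (A i) z
    _ = (A * Aᵀ) i i * ∑ j, z j ^ 2 := by simp [mul_apply, sq]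
    _ ≤ _ := mul_le_mul (apply_self_le_opNorm _ i) hz (by positivity) (norm_nonneg _)

theorem integral_eval_mul_eval (ι : Type*) [Fintype ι] [DecidableEq ι] (k l : ι) :
    ∫ z : ι → ℝ, z k * z l ∂Measure.pi (fun _ => gaussianReal 0 1) = if k = l then 1 else 0 := by
  split_ifs with hkl
  · subst hkl
    rw [integral_comp_eval (μ := fun _ : ι => gaussianReal 0 1) (i := k)
      (f := fun x : ℝ => x * x) (by fun_prop)]
    have := variance_fun_id_gaussianReal (μ := 0) (v := 1)
    rw [variance_of_integral_eq_zero (by fun_prop) (by simp)] at this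
    simpa [sq] using this
  · have hind := (iIndepFun_pi (μ := fun _ : ι => gaussianReal 0 1) (X := fun _ x => x)
      (fun _ => aemeasurable_id')).indepFun hkl
    rw [hind.integral_fun_mul_eq_mul_integral (measurable_pi_apply k).aestronglyMeasurable
      (measurable_pi_apply l).aestronglyMeasurable]
    simp [integral_eval]

theorem integral_pi_gaussianReal_of_odd {ι : Type*} [Fintype ι] {f : (ι → ℝ) → ℝ}
    (hf : ∀ z, f (-z) = -f z) : ∫ z, f z ∂Measure.pi (fun _ : ι => gaussianReal 0 1) = 0 := by
  have h := (measurePreserving_pi (fun _ : ι => gaussianReal 0 1) (fun _ => gaussianReal 0 1)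
    (f := fun _ x => -x) fun _ => ⟨measurable_neg, by simp [gaussianReal_map_neg]⟩)
  have := h.integral_comp (MeasurableEquiv.neg (ι → ℝ)).measurableEmbedding f
  have h2 : ∫ z, f (-z) ∂Measure.pi (fun _ : ι => gaussianReal 0 1) = _ := this
  simp only [hf, integral_neg] at h2
  linarith

theorem integrable_norm_pow_pi_gaussianReal (ι : Type*) [Fintype ι] (k : ℕ) :
    Integrable (fun z : ι → ℝ => ‖z‖ ^ k) (Measure.pi (fun _ : ι => gaussianReal 0 1)) := by
  rcases eq_or_ne k 0 with rfl | hk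
  · simp
  refine MemLp.integrable_norm_pow (f := id) (memLp_pi_iff.2 fun i => ?_) hk
  exact (memLp_id_gaussianReal' k (by simp)).comp_measurePreserving
    (measurePreserving_eval (fun _ => gaussianReal 0 1) i)

theorem integrable_multilinear_pi_gaussianReal {ι E : Type*} [Fintype ι] [NormedAddCommGroup E]
    [NormedSpace ℝ E] {k : ℕ}
    (T : ContinuousMultilinearMap ℝ (fun _ : Fin k => E) ℝ) (L : (ι → ℝ) →L[ℝ] E) :
    Integrable (fun z => T fun _ => L z) (Measure.pi (fun _ : ι => gaussianReal 0 1)) := by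
  refine ((integrable_norm_pow_pi_gaussianReal ι k).const_mul (‖T‖ * ‖L‖ ^ k)).mono'
    (Continuous.aestronglyMeasurable (by fun_prop)) (ae_of_all _ fun z => ?_)
  calc ‖T fun _ => L z‖ ≤ ‖T‖ * ‖L z‖ ^ k := by simpa using T.le_opNorm fun _ => L z
    _ ≤ ‖T‖ * (‖L‖ * ‖z‖) ^ k := by gcongr; exact L.le_opNorm z
    _ = _ := by ring

theorem iteratedFDeriv_two_eq_sum_hess {n : ℕ} {h : (Fin n → ℝ) → ℝ} (hh : ContDiff ℝ 2 h)
    (x v : Fin n → ℝ) :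
    iteratedFDeriv ℝ 2 h x (fun _ => v) = ∑ i, ∑ j, v i * v j * hess h x i j := by
  have hd : DifferentiableAt ℝ (fderiv ℝ h) x :=
    ((hh.fderiv_right (m := 1) (by norm_num)).differentiable (by norm_num)) x
  have hhess (i j) : hess h x i j =
      fderiv ℝ (fderiv ℝ h) x (Pi.single i 1) (Pi.single j 1) := by
    simp [hess, fderiv_clm_apply hd (differentiableAt_const _)]
  have hv : v = ∑ i, v i • Pi.single i (1 : ℝ) := pi_eq_sum_univ' v
  simp_rw [iteratedFDeriv_two_apply, hhess]
  conv_lhs => rw [hv]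
  simp only [map_sum, map_smul, _root_.sum_apply, _root_.smul_apply, smul_eq_mul, Finset.mul_sum]
  rw [Finset.sum_comm]
  exact Finset.sum_congr rfl fun _ _ => Finset.sum_congr rfl fun _ _ => by ring

theorem integrable_eval_mul_eval {ι : Type*} [Fintype ι] (k l : ι) :
    Integrable (fun z : ι → ℝ => z k * z l) (Measure.pi (fun _ : ι => gaussianReal 0 1)) := by
  refine (integrable_norm_pow_pi_gaussianReal ι 2).mono' (by fun_prop) (ae_of_all _ fun z => ?_)
  rw [norm_mul, sq]
  gcongr <;> exact norm_le_pi_norm z _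

theorem mulVec_mul_mulVec_eq_sum {n : ℕ} (A : Matrix (Fin n) (Fin n) ℝ) (i j : Fin n)
    (z : Fin n → ℝ) :
    (A *ᵥ z) i * (A *ᵥ z) j = ∑ k, ∑ l, A i k * A j l * (z k * z l) := by
  simp only [mulVec, dotProduct, Finset.sum_mul_sum]
  exact Finset.sum_congr rfl fun _ _ => Finset.sum_congr rfl fun _ _ => by ring

theorem integrable_mulVec_mul_mulVec {n : ℕ} (A : Matrix (Fin n) (Fin n) ℝ) (i j : Fin n) :
    Integrable (fun z => (A *ᵥ z) i * (A *ᵥ z) j)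
      (Measure.pi (fun _ : Fin n => gaussianReal 0 1)) := by
  simp_rw [mulVec_mul_mulVec_eq_sum]
  exact integrable_finsetSum _ fun k _ => integrable_finsetSum _ fun l _ =>
    (integrable_eval_mul_eval k l).const_mul _

theorem integral_mulVec_mul_mulVec {n : ℕ} (A : Matrix (Fin n) (Fin n) ℝ) (i j : Fin n) :
    ∫ z, (A *ᵥ z) i * (A *ᵥ z) j ∂Measure.pi (fun _ : Fin n => gaussianReal 0 1) =
      (A * Aᵀ) i j := by
  have hint (k l : Fin n) := integrable_eval_mul_eval k l
  simp_rw [mulVec_mul_mulVec_eq_sum]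
  rw [integral_finsetSum _ fun k _ => integrable_finsetSum _ fun l _ => (hint k l).const_mul _]
  simp_rw [integral_finsetSum _ fun l _ => (hint _ l).const_mul _, integral_const_mul,
    integral_eval_mul_eval]
  simp [mul_apply]

theorem integral_mul_gaussPdfMean {n : ℕ} (μ : Fin n → ℝ) (A : Matrix (Fin n) (Fin n) ℝ)
    (hA : A.det ≠ 0) {f : (Fin n → ℝ) → ℝ} (hf : Continuous f) :
    ∫ θ, f θ * gaussPdfMean μ (A * Aᵀ) θ =
      ∫ z, f (μ + A *ᵥ z) ∂Measure.pi (fun _ : Fin n => gaussianReal 0 1) := by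
  have hpdf := continuous_gaussPdfMean μ (A * Aᵀ)
  have h := integral_comp_toLin' A hA
    (f := fun θ => f (μ + θ) * gaussPdfMean μ (A * Aᵀ) (μ + θ)) (by fun_prop)
  rw [integral_add_left_eq_self (μ := volume) (fun θ => f θ * gaussPdfMean μ (A * Aᵀ) θ) μ] at h
  simp_rw [gaussPdfMean_mul_transpose μ A hA, mul_left_comm (f _), integral_const_mul] at h
  rw [integral_pi_gaussianReal]
  exact (mul_left_cancel₀ (inv_ne_zero (abs_ne_zero.2 hA)) h).symm

/-- Gaussian expectation of a `C⁵` function with bounded derivatives of orders 3–5: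
`∫ h dN(μ,Σ) = h(μ) + (1/2) Σ : ∇∇h(μ) + O(‖Σ‖² + ‖Σ‖^{5/2})`, with a constant
depending only on the dimension `n` and the derivative bounds. -/
theorem gaussian_expectation_second_order_expansion (n : ℕ) (B : ℝ) :
    ∃ C : ℝ, 0 ≤ C ∧
      ∀ (μ : Fin n → ℝ) (S : Matrix (Fin n) (Fin n) ℝ), S.PosDef →
        ∀ h : (Fin n → ℝ) → ℝ, ContDiff ℝ 5 h →
          (∀ k : ℕ, k = 3 ∨ k = 4 ∨ k = 5 →
            ∀ θ : Fin n → ℝ, ‖iteratedFDeriv ℝ k h θ‖ ≤ B) →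
          |(∫ θ : Fin n → ℝ, h θ * gaussPdfMean μ S θ)
              - h μ - (1 / 2) * ∑ i, ∑ j, S i j * hess h μ i j|
            ≤ C * (opNorm S ^ 2 + opNorm S ^ ((5 : ℝ) / 2)) := by
  set γ := Measure.pi (fun _ : Fin n => gaussianReal 0 1) with hγ
  refine ⟨|B| / 24 * n ^ 2 * ∫ z, ‖z‖ ^ 4 ∂γ, by positivity, fun μ S hS h hh hB => ?_⟩
  obtain ⟨A, hA, rfl⟩ := exists_eq_mul_transpose hS
  have hh4 : ContDiff ℝ 4 h := hh.of_le (by norm_num)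
  let L : (Fin n → ℝ) →L[ℝ] (Fin n → ℝ) := (toLin' A).toContinuousLinearMap
  let T (k : ℕ) (z : Fin n → ℝ) : ℝ := iteratedFDeriv ℝ k h μ fun _ => L z
  let R (z : Fin n → ℝ) : ℝ :=
    h (μ + L z) - h μ - T 1 z - 1 / 2 * T 2 z - 1 / 6 * T 3 z
  have hT (k : ℕ) : Integrable (T k) γ := integrable_multilinear_pi_gaussianReal _ L
  have hodd (k : ℕ) (hk : Odd k) : ∫ z, T k z ∂γ = 0 := by
    refine integral_pi_gaussianReal_of_odd fun z => ?_
    simp only [T, map_neg]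
    have := (iteratedFDeriv ℝ k h μ).map_smul_univ (fun _ => (-1 : ℝ)) (fun _ => L z)
    simpa [hk.neg_one_pow] using this
  have hT2 : ∫ z, T 2 z ∂γ = ∑ i, ∑ j, (A * Aᵀ) i j * hess h μ i j := by
    have hint (i j : Fin n) : Integrable (fun z => (A *ᵥ z) i * (A *ᵥ z) j) γ :=
      integrable_mulVec_mul_mulVec A i j
    simp_rw [T, iteratedFDeriv_two_eq_sum_hess (hh.of_le (by norm_num))]
    simp only [L, LinearMap.coe_toContinuousLinearMap', toLin'_apply]
    rw [integral_finsetSum _ fun i _ => integrable_finsetSum _ fun j _ => (hint i j).mul_const _]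
    simp_rw [integral_finsetSum _ fun j _ => (hint _ j).mul_const _, integral_mul_const, hγ,
      integral_mulVec_mul_mulVec]
  have hR (z : Fin n → ℝ) :
      ‖R z‖ ≤ |B| / 24 * n ^ 2 * opNorm (A * Aᵀ) ^ 2 * ‖z‖ ^ 4 := by
    calc ‖R z‖ ≤ |B| / 24 * (‖L z‖ ^ 2) ^ 2 := by
          rw [← pow_mul]
          exact abs_taylor_three_remainder_le hh4
            (fun x => (hB 4 (by simp) x).trans (le_abs_self B)) μ (L z)
      _ ≤ |B| / 24 * (opNorm (A * Aᵀ) * (n * ‖z‖ ^ 2)) ^ 2 := by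
          gcongr
          exact norm_mulVec_sq_le A z
      _ = _ := by ring
  have hz4 := integrable_norm_pow_pi_gaussianReal (Fin n) 4
  have hRint : Integrable R γ := by
    have := hh.continuous
    have := fun k => (iteratedFDeriv ℝ k h μ).cont
    exact (hz4.const_mul _).mono' (Continuous.aestronglyMeasurable (by fun_prop)) (ae_of_all _ hR)
  have hexp : ∫ z, h (μ + A *ᵥ z) ∂γ =
      h μ + 1 / 2 * ∑ i, ∑ j, (A * Aᵀ) i j * hess h μ i j + ∫ z, R z ∂γ := by
    have hsum (z : Fin n → ℝ) : h (μ + A *ᵥ z) =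
        h μ + T 1 z + 1 / 2 * T 2 z + 1 / 6 * T 3 z + R z := by
      simp only [R, L, LinearMap.coe_toContinuousLinearMap', toLin'_apply]
      ring
    simp_rw [hsum]
    have h1 : Integrable (fun z => h μ + T 1 z) γ := (integrable_const _).add (hT 1)
    have h2 : Integrable (fun z => h μ + T 1 z + 1 / 2 * T 2 z) γ := h1.add ((hT 2).const_mul _)
    have h3 : Integrable (fun z => h μ + T 1 z + 1 / 2 * T 2 z + 1 / 6 * T 3 z) γ :=
      h2.add ((hT 3).const_mul _)
    rw [integral_add h3 hRint, integral_add h2 ((hT 3).const_mul _),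
      integral_add h1 ((hT 2).const_mul _), integral_add (integrable_const _) (hT 1),
      integral_const_mul, integral_const_mul, hodd 1 (by decide), hodd 3 (by decide), hT2]
    simp
  rw [integral_mul_gaussPdfMean μ A hA hh.continuous, ← hγ, hexp]
  have hop : 0 ≤ opNorm (A * Aᵀ) := norm_nonneg _
  calc _ = ‖∫ z, R z ∂γ‖ := by rw [Real.norm_eq_abs]; ring_nf
    _ ≤ ∫ z, |B| / 24 * n ^ 2 * opNorm (A * Aᵀ) ^ 2 * ‖z‖ ^ 4 ∂γ :=
        norm_integral_le_of_norm_le (hz4.const_mul _) (ae_of_all _ hR)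
    _ = |B| / 24 * n ^ 2 * (∫ z, ‖z‖ ^ 4 ∂γ) * opNorm (A * Aᵀ) ^ 2 := by
        rw [integral_const_mul]
        ring
    _ ≤ _ := by
        gcongr
        exact le_add_of_nonneg_right (by positivity)

end
end

section
/- (Fourth-order accuracy of the regularized discrete Dirac delta.) Fix h > 0, a grid point x_k, and α ∈ [0,1), and set x_s = x_k + αh and x_j = x_k + (j−k)h. Define P(α) = 5α⁵/3 − 7α⁶/24 − 17α⁷/12 + 9α⁸/8 − α⁹/4 and the discrete delta coefficients δ_{k−2} = (α/12 − α²/24 − α³/12 − 19α⁴/24 + P(α))/h, δ_{k−1} = (−2α/3 + 2α²/3 + α³/6 + 4α⁴ − 5P(α))/h, δ_k = (1 − 5α²/4 − 97α⁴/12 + 10P(α))/h, δ_{k+1} = (2α/3 + 2α²/3 − α³/6 + 49α⁴/6 − 10P(α))/h, δ_{k+2} = (−α/12 − α²/24 + α³/12 − 33α⁴/8 + 5P(α))/h, δ_{k+3} = (5α⁴/6 − P(α))/h, and δ_j = 0 for all other j. Then for every polynomial q of degree at most 4, the discrete scalar product reproduces point evaluation: h · Σ_{j∈ℤ} δ_j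 q(x_j) = q(x_s). -/
/-- **Fourth-order accuracy of the regularized discrete Dirac delta.**  With
`x_s = x_k + αh`, `x_j = x_k + (j−k)h` and the six-point discrete delta coefficients
built from `P(α)`, the discrete scalar product reproduces point evaluation,
`h · Σ_j δ_j q(x_j) = q(x_s)`, for every polynomial `q` of degree at most 4. -/
theorem discrete_dirac_delta_fourth_order
    (h : ℝ) (hh : 0 < h) (k : ℤ) (xk : ℝ) (α : ℝ) (hα0 : 0 ≤ α) (hα1 : α < 1)
    (q : Polynomial ℝ) (hq : q.natDegree ≤ 4)
    (P : ℝ) (hP : P = 5 * α ^ 5 / 3 - 7 * α ^ 6 / 24 - 17 * α ^ 7 / 12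
      + 9 * α ^ 8 / 8 - α ^ 9 / 4)
    (δ : ℤ → ℝ)
    (hδ : ∀ j : ℤ, δ j =
      if j = k - 2 then (α / 12 - α ^ 2 / 24 - α ^ 3 / 12 - 19 * α ^ 4 / 24 + P) / h
      else if j = k - 1 then (-2 * α / 3 + 2 * α ^ 2 / 3 + α ^ 3 / 6 + 4 * α ^ 4 - 5 * P) / h
      else if j = k then (1 - 5 * α ^ 2 / 4 - 97 * α ^ 4 / 12 + 10 * P) / h
      else if j = k + 1 then (2 * α / 3 + 2 * α ^ 2 / 3 - α ^ 3 / 6 + 49 * α ^ 4 / 6 - 10 * P) / h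
      else if j = k + 2 then (-α / 12 - α ^ 2 / 24 + α ^ 3 / 12 - 33 * α ^ 4 / 8 + 5 * P) / h
      else if j = k + 3 then (5 * α ^ 4 / 6 - P) / h
      else 0) :
    h * ∑ᶠ j : ℤ, δ j * q.eval (xk + ((j - k : ℤ) : ℝ) * h) = q.eval (xk + α * h) := by
  have hsupp : (Function.support fun j : ℤ => δ j * q.eval (xk + ((j - k : ℤ) : ℝ) * h)) ⊆
      (({k - 2, k - 1, k, k + 1, k + 2, k + 3} : Finset ℤ) : Set ℤ) := by
    intro j hj
    contrapose! hj
    simp only [Finset.coe_insert, Finset.coe_singleton, Set.mem_insert_iff,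
      Set.mem_singleton_iff, not_or] at hj
    simp [hδ, hj]
  have hinj : Function.Injective (fun i : ℤ => k + i) := add_right_injective k
  have himage : ({k - 2, k - 1, k, k + 1, k + 2, k + 3} : Finset ℤ) =
      ({-2, -1, 0, 1, 2, 3} : Finset ℤ).image (fun i => k + i) := by
    simp [Finset.image_insert, sub_eq_add_neg]
  rw [finsum_eq_sum_of_support_subset _ hsupp, himage, Finset.sum_image hinj.injOn]
  have hshift (i j : ℤ) : k + i = k + j ↔ i = j := add_right_inj k
  have hzero (i : ℤ) : k + i = k ↔ i = 0 := add_eq_left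
  simp only [hδ, sub_eq_add_neg k, hshift, hzero, add_sub_cancel_left]
  simp only [Polynomial.eval_eq_sum_range' (Nat.lt_succ_of_le hq), Finset.sum_range_succ,
    Finset.sum_range_zero]
  simp
  field_simp
  ring
end

section
/- (Fourth-order accuracy of the regularized discrete derivative of the Dirac delta.) Fix h > 0, a grid point x_k, and α ∈ [0,1), and set x_s = x_k + αh and x_j = x_k + (j−k)h. Define R(α) = −25α⁴/12 − 3α⁵/4 + 59α⁶/12 − 4α⁷ + α⁸ and the coefficients δ'_{k−2} = (−1/12 + α/12 + α²/4 + 2α³/3 + R(α))/h², δ'_{k−1} = (2/3 − 4α/3 − α²/2 − 7α³/2 − 5R(α))/h², δ'_k = (5α/2 + 22α³/3 + 10R(α))/h², δ'_{k+1} = (−2/3 − 4α/3 + α²/2 − 23α³/3 − 10R(α))/h², δ'_{k+2} = (1/12 + α/12 − α²/4 + 4α³ + 5R(α))/h², δ'_{k+3} = (−5α³/6 − R(α))/h², and δ'_j = 0 for all other j. Then for every polynomial q of degree at most 4, the discrete scalar product reproduces (minus) the derivative: h · Σ_{j∈ℤ} δ'_j q(x_j) = −q'(x_s). -/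
/-- **Fourth-order accuracy of the regularized discrete derivative of the Dirac delta.**
With `x_s = x_k + αh`, `x_j = x_k + (j−k)h` and the six-point discrete stencil built from
`R(α)`, the discrete scalar product reproduces minus the derivative,
`h · Σ_j δ'_j q(x_j) = −q'(x_s)`, for every polynomial `q` of degree at most 4. -/
theorem discrete_dirac_delta_derivative_fourth_order
    (h : ℝ) (hh : 0 < h) (k : ℤ) (xk : ℝ) (α : ℝ) (hα0 : 0 ≤ α) (hα1 : α < 1)
    (q : Polynomial ℝ) (hq : q.natDegree ≤ 4)
    (R : ℝ) (hR : R = -25 * α ^ 4 / 12 - 3 * α ^ 5 / 4 + 59 * α ^ 6 / 12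
      - 4 * α ^ 7 + α ^ 8)
    (δ' : ℤ → ℝ)
    (hδ' : ∀ j : ℤ, δ' j =
      if j = k - 2 then (-1 / 12 + α / 12 + α ^ 2 / 4 + 2 * α ^ 3 / 3 + R) / h ^ 2
      else if j = k - 1 then (2 / 3 - 4 * α / 3 - α ^ 2 / 2 - 7 * α ^ 3 / 2 - 5 * R) / h ^ 2
      else if j = k then (5 * α / 2 + 22 * α ^ 3 / 3 + 10 * R) / h ^ 2
      else if j = k + 1 then (-2 / 3 - 4 * α / 3 + α ^ 2 / 2 - 23 * α ^ 3 / 3 - 10 * R) / h ^ 2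
      else if j = k + 2 then (1 / 12 + α / 12 - α ^ 2 / 4 + 4 * α ^ 3 + 5 * R) / h ^ 2
      else if j = k + 3 then (-5 * α ^ 3 / 6 - R) / h ^ 2
      else 0) :
    h * ∑ᶠ j : ℤ, δ' j * q.eval (xk + ((j - k : ℤ) : ℝ) * h)
      = -(q.derivative.eval (xk + α * h)) := by
  have hsupp : Function.support
      (fun j : ℤ => δ' j * q.eval (xk + ((j - k : ℤ) : ℝ) * h)) ⊆
      ↑(({-2, -1, 0, 1, 2, 3} : Finset ℤ).image (fun i => k + i)) := by
    intro j hj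
    by_contra hmem
    apply hj
    simp only [Finset.coe_image, Set.mem_image, Finset.mem_coe, Finset.mem_insert,
      Finset.mem_singleton, not_exists, not_and] at hmem
    have hne := hmem (j - k)
    have hzero : δ' j = 0 := by
      rw [hδ' j]
      iterate 6 rw [if_neg (by omega)]
    simp [hzero]
  rw [finsum_eq_sum_of_support_subset _ hsupp,
    Finset.sum_image (fun a _ b _ hab => add_left_cancel hab)]
  have hm2 : δ' (k + -2) = _ := (hδ' _).trans (if_pos (by ring))
  have hm1 : δ' (k + -1) = (2 / 3 - 4 * α / 3 - α ^ 2 / 2 - 7 * α ^ 3 / 2 - 5 * R) / h ^ 2 := by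
    rw [hδ', if_neg (by omega), if_pos (by ring)]
  have h0 : δ' (k + 0) = (5 * α / 2 + 22 * α ^ 3 / 3 + 10 * R) / h ^ 2 := by
    rw [hδ', if_neg (by omega), if_neg (by omega), if_pos (by ring)]
  have h1 : δ' (k + 1) =
      (-2 / 3 - 4 * α / 3 + α ^ 2 / 2 - 23 * α ^ 3 / 3 - 10 * R) / h ^ 2 := by
    rw [hδ', if_neg (by omega), if_neg (by omega), if_neg (by omega), if_pos rfl]
  have h2 : δ' (k + 2) = (1 / 12 + α / 12 - α ^ 2 / 4 + 4 * α ^ 3 + 5 * R) / h ^ 2 := by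
    rw [hδ', if_neg (by omega), if_neg (by omega), if_neg (by omega), if_neg (by omega),
      if_pos rfl]
  have h3 : δ' (k + 3) = (-5 * α ^ 3 / 6 - R) / h ^ 2 := by
    rw [hδ', if_neg (by omega), if_neg (by omega), if_neg (by omega), if_neg (by omega),
      if_neg (by omega), if_pos rfl]
  have hq5 : q.natDegree < 5 := by omega
  have hderiv : q.derivative.natDegree < 4 + 1 :=
    (Polynomial.natDegree_derivative_le q).trans_lt (by omega)
  have hcoeff : q.coeff 5 = 0 := Polynomial.coeff_eq_zero_of_natDegree_lt hq5
  simp only [Polynomial.eval_eq_sum_range' hq5, Polynomial.eval_eq_sum_range' hderiv,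
    Polynomial.coeff_derivative, Finset.sum_range_succ, Finset.sum_range_zero, hcoeff]
  rw [Finset.sum_insert (by decide), Finset.sum_insert (by decide), Finset.sum_insert (by decide),
    Finset.sum_insert (by decide), Finset.sum_insert (by decide), Finset.sum_singleton,
    hm2, hm1, h0, h1, h2, h3]
  simp only [add_sub_cancel_left]
  push_cast
  field_simp
  ring
end
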